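/- arXiv:math/0412333 — 2 statements merged into one kernel-verified Lean document; each statement's English description precedes it below -/
import Mathlib

section
/- Let G be a finite group generated by g_1,…,g_r, and consider the Diaconis urn process: the urn starts with one ball labeled by each generator, and at each step two balls are drawn uniformly with replacement and a new ball labeled by the product of their labels is added. Let p_{g,n} be the fraction of balls labeled g when the urn contains n balls. Then almost surely, for every g ∈ G, p_{g,n} → 1/|G| as n → ∞. -/
open MeasureTheory Filter

namespace DiaconisUrn

/-- The harmonic sum `∑_{1 ≤ k < n} 1 / k`. -/
noncomputable def harmonicSum (n : ℕ) : ℝ := ∑ k ∈ Finset.range n, (k : ℝ)⁻¹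

lemma harmonicSum_succ (n : ℕ) : harmonicSum (n + 1) = harmonicSum n + (n : ℝ)⁻¹ :=
  Finset.sum_range_succ _ _

lemma harmonicSum_mono : Monotone harmonicSum :=
  monotone_nat_of_le_succ fun n => by
    rw [harmonicSum_succ]
    exact le_add_of_nonneg_right (by positivity)

lemma harmonicSum_nonneg (n : ℕ) : 0 ≤ harmonicSum n :=
  Finset.sum_nonneg fun _ _ => by positivity

lemma sum_Ico_inv {r n : ℕ} (h : r ≤ n) :
    ∑ k ∈ Finset.Ico r n, (k : ℝ)⁻¹ = harmonicSum n - harmonicSum r :=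
  Finset.sum_Ico_eq_sub _ h

lemma tendsto_harmonicSum_atTop : Tendsto harmonicSum atTop atTop :=
  (not_summable_iff_tendsto_nat_atTop_of_nonneg fun _ => by positivity).1
    Real.not_summable_natCast_inv

lemma tendsto_harmonicSum_sub_log :
    Tendsto (fun n : ℕ => harmonicSum n - Real.log n) atTop
      (nhds Real.eulerMascheroniConstant) := by
  rw [← tendsto_add_atTop_iff_nat 1]
  refine Real.tendsto_eulerMascheroniSeq.congr fun n => ?_
  simp [Real.eulerMascheroniSeq, harmonicSum, harmonic, Finset.sum_range_succ']

/-- The number of the first `n` terms of `x` that satisfy `P`. -/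
def tally {G : Type*} (x : ℕ → G) (P : G → Prop) [DecidablePred P] (n : ℕ) : ℕ :=
  ((Finset.range n).filter fun k => P (x k)).card

section Tally

variable {G : Type*} (x : ℕ → G) (P : G → Prop) [DecidablePred P]

lemma tally_succ (n : ℕ) : tally x P (n + 1) = tally x P n + if P (x n) then 1 else 0 := by
  unfold tally
  rw [Finset.range_add_one, Finset.filter_insert]
  split_ifs <;> simp

lemma tally_mono : Monotone (tally x P) :=
  monotone_nat_of_le_succ fun n => by rw [tally_succ]; exact Nat.le_add_right _ _

lemma tally_le (n : ℕ) : tally x P n ≤ n :=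
  (Finset.card_filter_le _ _).trans_eq (Finset.card_range n)

lemma tally_eq_sum (n : ℕ) :
    (tally x P n : ℝ) = ∑ k ∈ Finset.range n, if P (x k) then (1 : ℝ) else 0 := by
  simp [tally]

lemma one_le_tally {x : ℕ → G} {P : G → Prop} [DecidablePred P] {k n : ℕ} (hk : k < n)
    (hP : P (x k)) : 1 ≤ tally x P n :=
  Finset.card_pos.2 ⟨k, by simp [hk, hP]⟩

lemma tally_congr {x y : ℕ → G} {n : ℕ} (h : ∀ k < n, x k = y k) : tally x P n = tally y P n := by
  unfold tally
  congr 1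
  refine Finset.filter_congr fun k hk => ?_
  rw [h k (Finset.mem_range.1 hk)]

lemma harmonicSum_tally (n : ℕ) :
    harmonicSum (tally x P n) =
      ∑ k ∈ Finset.range n, (if P (x k) then (1 : ℝ) else 0) / tally x P k := by
  induction n with
  | zero => simp [tally, harmonicSum]
  | succ n ih =>
    rw [Finset.sum_range_succ, ← ih, tally_succ]
    split_ifs <;> simp [harmonicSum_succ]

lemma sum_Ico_div_tally {r n : ℕ} (h : r ≤ n) :
    ∑ k ∈ Finset.Ico r n, (if P (x k) then (1 : ℝ) else 0) / tally x P k =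
      harmonicSum (tally x P n) - harmonicSum (tally x P r) := by
  rw [Finset.sum_Ico_eq_sub _ h, ← harmonicSum_tally, ← harmonicSum_tally]

lemma sum_comp_eq_sum_tally [Fintype G] [DecidableEq G] (f : G → ℝ) (n : ℕ) :
    ∑ i ∈ Finset.range n, f (x i) = ∑ a, tally x (· = a) n * f a := by
  simp_rw [tally_eq_sum, Finset.sum_mul]
  rw [Finset.sum_comm]
  simp

lemma harmonicSum_sub_harmonicSum_tally_nonneg (n : ℕ) :
    0 ≤ harmonicSum n - harmonicSum (tally x P n) :=
  sub_nonneg.2 (harmonicSum_mono (tally_le x P n))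

lemma sum_tally_div [Fintype G] [DecidableEq G] {n : ℕ} (hn : n ≠ 0) :
    ∑ a, (tally x (· = a) n : ℝ) / n = 1 := by
  rw [← Finset.sum_div, div_eq_one_iff_eq (by exact_mod_cast hn)]
  simpa using (sum_comp_eq_sum_tally x (fun _ => 1) n).symm

end Tally

section Draw

variable {G : Type*} [Group G] [DecidableEq G] (x : ℕ → G)

/-- The probability that the product of two labels drawn uniformly with replacement among the
first `n` terms of `x` is `a`. -/
noncomputable def drawProb (n : ℕ) (a : G) : ℝ :=
  (∑ i : Fin n, ∑ j : Fin n, if x (i : ℕ) * x (j : ℕ) = a then (1 : ℝ) else 0) / (n : ℝ) ^ 2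

lemma drawProb_nonneg (n : ℕ) (a : G) : 0 ≤ drawProb x n a := by
  unfold drawProb
  positivity

lemma drawProb_le_one (n : ℕ) (a : G) : drawProb x n a ≤ 1 := by
  refine div_le_one_of_le₀ ?_ (by positivity)
  calc _ ≤ ∑ i : Fin n, ∑ j : Fin n, (1 : ℝ) := by
        gcongr
        split_ifs <;> norm_num
    _ = (n : ℝ) ^ 2 := by simp [sq]

lemma drawProb_congr {x y : ℕ → G} {n : ℕ} (h : ∀ k < n, x k = y k) :
    drawProb x n = drawProb y n := by
  ext a
  simp [drawProb, h]

variable [Fintype G]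

lemma sum_mul_drawProb (f : G → ℝ) (n : ℕ) :
    ∑ a, f a * drawProb x n a =
      (∑ i ∈ Finset.range n, ∑ j ∈ Finset.range n, f (x i * x j)) / (n : ℝ) ^ 2 := by
  simp_rw [drawProb, ← mul_div_assoc, ← Finset.sum_div, Finset.mul_sum]
  rw [Finset.sum_comm, Finset.sum_range]
  congr 1
  refine Finset.sum_congr rfl fun i _ => ?_
  rw [Finset.sum_comm, Finset.sum_range]
  simp

lemma sum_mul_drawProb_eq_sum_tally (f : G → ℝ) (n : ℕ) :
    ∑ a, f a * drawProb x n a =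
      (∑ y, tally x (· = y) n * ∑ z, tally x (· = z) n * f (y * z)) / (n : ℝ) ^ 2 := by
  rw [sum_mul_drawProb, ← sum_comp_eq_sum_tally x fun y => ∑ z, tally x (· = z) n * f (y * z)]
  simp_rw [← sum_comp_eq_sum_tally x]

lemma tally_mul_tally_le_drawProb (n : ℕ) (y z : G) :
    tally x (· = y) n * tally x (· = z) n / (n : ℝ) ^ 2 ≤ drawProb x n (y * z) := by
  have h := sum_mul_drawProb_eq_sum_tally x (fun a => if a = y * z then (1 : ℝ) else 0) n
  simp only [ite_mul, one_mul, zero_mul, Finset.sum_ite_eq', Finset.mem_univ, if_true] at h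
  rw [h]
  gcongr
  calc (tally x (· = y) n * tally x (· = z) n : ℝ)
      ≤ tally x (· = y) n * ∑ w, tally x (· = w) n * if y * w = y * z then (1 : ℝ) else 0 := by
        simp
    _ ≤ _ := Finset.single_le_sum
        (f := fun y' => (tally x (· = y') n : ℝ) *
          ∑ w, tally x (· = w) n * if y' * w = y * z then (1 : ℝ) else 0)
        (fun y' _ => by positivity) (Finset.mem_univ y)

/-- The compensated sums `∑_{r ≤ k < n} ∑_a c k a (1{x k = a} - drawProb x k a)`. -/
noncomputable def compensated (c : ℕ → G → ℝ) (r n : ℕ) : ℝ :=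
  ∑ k ∈ Finset.Ico r n, ∑ a, c k a * ((if x k = a then (1 : ℝ) else 0) - drawProb x k a)

lemma compensated_eq (c : ℕ → G → ℝ) (r n : ℕ) :
    compensated x c r n = ∑ k ∈ Finset.Ico r n, c k (x k) -
      ∑ k ∈ Finset.Ico r n, ∑ a, c k a * drawProb x k a := by
  simp [compensated, mul_sub, Finset.sum_sub_distrib]

/-- A draw lands outside a subgroup whenever exactly one of the two labels is outside. -/
lemma two_mul_tally_mul_le_sum_drawProb (H : Subgroup G) [DecidablePred (· ∉ H)] (n : ℕ) :
    2 * tally x (· ∉ H) n * (n - tally x (· ∉ H) n) / (n : ℝ) ^ 2 ≤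
      ∑ a, (if a ∉ H then (1 : ℝ) else 0) * drawProb x n a := by
  rw [sum_mul_drawProb]
  gcongr
  set o : G → ℝ := fun a => if a ∉ H then (1 : ℝ) else 0 with ho
  have key : ∀ a b : G, o a * (1 - o b) + (1 - o a) * o b ≤ o (a * b) := by
    intro a b
    simp only [ho]
    by_cases ha : a ∈ H <;> by_cases hb : b ∈ H
    · simp [ha, hb, H.mul_mem ha hb]
    · simp [ha, hb, H.mul_mem_cancel_left ha]
    · simp [ha, hb, H.mul_mem_cancel_right hb]
    · simp [ha, hb]
      split_ifs <;> norm_num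
  have ht : (tally x (· ∉ H) n : ℝ) = ∑ k ∈ Finset.range n, o (x k) := tally_eq_sum _ _ _
  have hn : (n : ℝ) - tally x (· ∉ H) n = ∑ k ∈ Finset.range n, (1 - o (x k)) := by
    rw [ht]; simp
  calc 2 * (tally x (· ∉ H) n : ℝ) * (n - tally x (· ∉ H) n)
      = ∑ i ∈ Finset.range n, ∑ j ∈ Finset.range n,
          (o (x i) * (1 - o (x j)) + (1 - o (x i)) * o (x j)) := by
        simp_rw [Finset.sum_add_distrib, ← Finset.mul_sum, ← Finset.sum_mul]
        rw [← hn, ← ht]; ring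
    _ ≤ _ := by gcongr; exact key _ _

end Draw

section Martingale

variable {G : Type*} [MeasurableSpace G] {Ω : Type*} {m0 : MeasurableSpace Ω}

/-- The filtration generated by the labels of the first `n` balls. -/
def history (X : ℕ → Ω → G) (hX : ∀ k, Measurable (X k)) : Filtration ℕ m0 where
  seq n := MeasurableSpace.comap (fun ω (i : Fin n) => X (i : ℕ) ω) inferInstance
  mono' m n hmn := by
    have hr : Measurable fun (u : Fin n → G) (i : Fin m) => u (Fin.castLE hmn i) := by fun_prop
    rintro s ⟨t, ht, rfl⟩
    exact ⟨_, hr ht, rfl⟩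
  le' n := Measurable.comap_le (measurable_pi_lambda _ fun i => hX i)

lemma exists_factor {G : Type*} [Nonempty G] {f : (ℕ → G) → ℝ} {n : ℕ}
    (hf : ∀ x y : ℕ → G, (∀ k < n, x k = y k) → f x = f y) :
    ∃ f' : (Fin n → G) → ℝ, ∀ x, f x = f' fun i => x i := by
  classical
  refine ⟨fun u => f fun k => if h : k < n then u ⟨k, h⟩ else Classical.arbitrary G,
    fun x => hf _ _ fun k hk => by simp [hk]⟩

variable [Finite G] [MeasurableSingletonClass G] [Nonempty G]
  (X : ℕ → Ω → G) (hX : ∀ k, Measurable (X k)) {f : (ℕ → G) → ℝ} {n : ℕ}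

lemma stronglyMeasurable_history (hf : ∀ x y : ℕ → G, (∀ k < n, x k = y k) → f x = f y) :
    StronglyMeasurable[history X hX n] fun ω => f fun k => X k ω := by
  obtain ⟨f', hf'⟩ := exists_factor hf
  simp_rw [hf']
  refine Measurable.stronglyMeasurable ?_
  exact (measurable_of_countable f').comp (comap_measurable _)

include hX in
lemma integrable_of_eq_of_prefix_eq (μ : Measure Ω) [IsFiniteMeasure μ]
    (hf : ∀ x y : ℕ → G, (∀ k < n, x k = y k) → f x = f y) :
    Integrable (fun ω => f fun k => X k ω) μ := by
  have hm := (stronglyMeasurable_history X hX hf).mono ((history X hX).le n)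
  obtain ⟨f', hf'⟩ := exists_factor hf
  have := Fintype.ofFinite (Fin n → G)
  refine Integrable.of_bound hm.aestronglyMeasurable (∑ u, ‖f' u‖) (ae_of_all _ fun ω => ?_)
  rw [hf']
  exact Finset.single_le_sum (f := fun u => ‖f' u‖) (fun _ _ => norm_nonneg _)
    (Finset.mem_univ _)

end Martingale

/-- The real sequence `Y` converges as soon as it is bounded above. -/
def ConvergesOfBddAbove (Y : ℕ → ℝ) : Prop :=
  BddAbove (Set.range Y) → ∃ l, Tendsto Y atTop (nhds l)

/-- For bounded predictable weights, the compensated sums of an urn process are almost surely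
convergent as soon as they are bounded above. -/
lemma ae_convergesOfBddAbove_compensated
    {G : Type*} [Group G] [Fintype G] [DecidableEq G]
    [MeasurableSpace G] [MeasurableSingletonClass G]
    {Ω : Type*} {m0 : MeasurableSpace Ω} {μ : Measure Ω} [IsProbabilityMeasure μ]
    {r : ℕ} {X : ℕ → Ω → G} (hX : ∀ k, Measurable (X k))
    (hcond : ∀ n, r ≤ n → ∀ a : G,
      μ[(fun ω => if X n ω = a then (1 : ℝ) else 0) | history X hX n]
        =ᵐ[μ] fun ω => drawProb (fun k => X k ω) n a)
    (c : (ℕ → G) → ℕ → G → ℝ)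
    (hc : ∀ x y n, (∀ k < n, x k = y k) → c x n = c y n)
    (hc1 : ∀ x n a, |c x n a| ≤ 1) :
    ∀ᵐ ω ∂μ, ConvergesOfBddAbove (compensated (fun k => X k ω) (c fun k => X k ω) r) := by
  set Y : ℕ → Ω → ℝ := fun n ω => compensated (fun k => X k ω) (c fun k => X k ω) r n with hY
  have hdep : ∀ n, ∀ x y : ℕ → G, (∀ k < n, x k = y k) →
      compensated x (c x) r n = compensated y (c y) r n := by
    intro n x y h
    refine Finset.sum_congr rfl fun k hk => ?_
    have hk' := (Finset.mem_Ico.1 hk).2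
    have h' : ∀ j < k, x j = y j := fun j hj => h j (hj.trans hk')
    rw [hc x y k h', drawProb_congr h', h k hk']
  have hdiff : ∀ n ω, Y (n + 1) ω - Y n ω = if r ≤ n then
      ∑ a, c (fun k => X k ω) n a *
        ((if X n ω = a then (1 : ℝ) else 0) - drawProb (fun k => X k ω) n a) else 0 := by
    intro n ω
    simp only [hY, compensated]
    split_ifs with h
    · rw [Finset.sum_Ico_succ_top h, add_sub_cancel_left]
    · push Not at h
      rw [Finset.Ico_eq_empty_of_le h.le, Finset.Ico_eq_empty_of_le (by omega), sub_self]
  have hmart : Martingale Y (history X hX) μ := by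
    refine martingale_of_condExp_sub_eq_zero_nat
      (fun n => stronglyMeasurable_history X hX (hdep n))
      (fun n => integrable_of_eq_of_prefix_eq X hX μ (hdep n)) fun n => ?_
    have hle : history X hX n ≤ m0 := (history X hX).le n
    by_cases hn : r ≤ n
    · set I : G → Ω → ℝ := fun a ω => if X n ω = a then (1 : ℝ) else 0 with hI
      set p : G → Ω → ℝ := fun a ω => drawProb (fun k => X k ω) n a with hp
      set C : G → Ω → ℝ := fun a ω => c (fun k => X k ω) n a with hC
      have hpm : ∀ a, StronglyMeasurable[history X hX n] (p a) := fun a =>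
        stronglyMeasurable_history X hX (f := fun x => drawProb x n a)
          fun x y h => by rw [drawProb_congr h]
      have hCm : ∀ a, StronglyMeasurable[history X hX n] (C a) := fun a =>
        stronglyMeasurable_history X hX (f := fun x => c x n a)
          fun x y h => by rw [hc x y n h]
      have hpi : ∀ a, Integrable (p a) μ := fun a =>
        integrable_of_eq_of_prefix_eq X hX μ (f := fun x => drawProb x n a)
          fun x y h => by rw [drawProb_congr h]
      have hIi : ∀ a, Integrable (I a) μ := fun a =>
        integrable_of_eq_of_prefix_eq X hX μ (n := n + 1)
          (f := fun x => if x n = a then (1 : ℝ) else 0)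
          fun x y h => by rw [h n (Nat.lt_succ_self n)]
      have hCi : ∀ a, Integrable (C a * (I a - p a)) μ := fun a =>
        integrable_of_eq_of_prefix_eq X hX μ (n := n + 1)
          (f := fun x => c x n a * ((if x n = a then (1 : ℝ) else 0) - drawProb x n a))
          fun x y h => by
            have h' : ∀ j < n, x j = y j := fun j hj => h j (hj.trans (Nat.lt_succ_self n))
            rw [h n (Nat.lt_succ_self n), hc x y n h', drawProb_congr h']
      have hz : ∀ a, μ[C a * (I a - p a) | history X hX n] =ᵐ[μ] 0 := by
        intro a
        have h1 := condExp_mul_of_stronglyMeasurable_left (hCm a) (hCi a) ((hIi a).sub (hpi a))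
        have h2 := condExp_sub (hIi a) (hpi a) (history X hX n)
        rw [condExp_of_stronglyMeasurable hle (hpm a) (hpi a)] at h2
        filter_upwards [h1, h2, hcond n hn a] with ω e1 e2 e3
        rw [e1, Pi.mul_apply, e2, Pi.sub_apply, e3]
        simp [hp]
      have hsum : Y (n + 1) - Y n = ∑ a, C a * (I a - p a) := by
        ext ω
        rw [Pi.sub_apply, hdiff, if_pos hn, Finset.sum_apply]
        rfl
      rw [hsum]
      refine (condExp_finsetSum (fun a _ => hCi a) _).trans ?_
      filter_upwards [ae_all_iff.2 hz] with ω hω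
      rw [Finset.sum_apply]
      exact Finset.sum_eq_zero fun a _ => hω a
    · have : Y (n + 1) - Y n = 0 := by
        ext ω
        rw [Pi.sub_apply, hdiff, if_neg hn, Pi.zero_apply]
      rw [this, condExp_zero]
  have hbdd : ∀ᵐ ω ∂μ, ∀ i, |Y (i + 1) ω - Y i ω| ≤ (Fintype.card G : NNReal) := by
    refine ae_of_all _ fun ω i => ?_
    rw [hdiff]
    split_ifs
    · refine (Finset.abs_sum_le_sum_abs _ _).trans ?_
      calc _ ≤ ∑ a : G, (1 : ℝ) := Finset.sum_le_sum fun a _ => by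
            rw [abs_mul]
            refine mul_le_one₀ (hc1 _ _ _) (abs_nonneg _) ?_
            have h0 := drawProb_nonneg (fun k => X k ω) i a
            have h1 := drawProb_le_one (fun k => X k ω) i a
            rw [abs_le]
            split_ifs <;> constructor <;> linarith
        _ = _ := by simp
    · simp
  filter_upwards [hmart.submartingale.bddAbove_iff_exists_tendsto hbdd] with ω hω using hω.1

section Support

variable {G : Type*} [Group G] [Fintype G] [DecidableEq G] {x : ℕ → G} {r : ℕ}

/-- The density of the labels outside a proper subgroup does not tend to zero too quickly. -/
lemma not_summable_tally_notMem {H : Subgroup G} [DecidablePred (· ∉ H)]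
    (hout : 1 ≤ tally x (· ∉ H) r)
    (hconv : ConvergesOfBddAbove (compensated x
      (fun k a => (if a ∉ H then (1 : ℝ) else 0) / tally x (· ∉ H) k) r)) :
    ¬ Summable fun k : ℕ => (tally x (· ∉ H) k : ℝ) / (k : ℝ) ^ 2 := by
  intro hs
  set M := tally x (· ∉ H) with hM
  set T := ∑' k : ℕ, (M k : ℝ) / (k : ℝ) ^ 2
  set Y := compensated x (fun k a => (if a ∉ H then (1 : ℝ) else 0) / M k) r with hY
  have hbound : ∀ n, r ≤ n → Y n ≤ 2 * harmonicSum r + 2 * T - harmonicSum n := by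
    intro n hn
    have hdrift : ∑ k ∈ Finset.Ico r n, (2 * (k : ℝ)⁻¹ - 2 * ((M k : ℝ) / (k : ℝ) ^ 2)) ≤
        ∑ k ∈ Finset.Ico r n,
          ∑ a, (if a ∉ H then (1 : ℝ) else 0) / M k * drawProb x k a := by
      refine Finset.sum_le_sum fun k hk => ?_
      have hk1 : 1 ≤ M k := hout.trans (tally_mono x _ (Finset.mem_Ico.1 hk).1)
      have hM0 : (0 : ℝ) < M k := by exact_mod_cast hk1
      have hk0 : (0 : ℝ) < k := by exact_mod_cast hk1.trans (tally_le x _ k)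
      have h := two_mul_tally_mul_le_sum_drawProb x H k
      rw [← hM] at h
      simp_rw [div_mul_eq_mul_div, ← Finset.sum_div]
      rw [le_div_iff₀ hM0]
      refine le_trans (le_of_eq ?_) h
      field_simp
    have hT : ∑ k ∈ Finset.Ico r n, (M k : ℝ) / (k : ℝ) ^ 2 ≤ T :=
      hs.sum_le_tsum _ fun _ _ => by positivity
    rw [Finset.sum_sub_distrib, ← Finset.mul_sum, ← Finset.mul_sum, sum_Ico_inv hn] at hdrift
    have h1 := harmonicSum_mono (tally_le x (· ∉ H) n)
    have h2 := harmonicSum_nonneg (M r)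
    have h3 := sum_Ico_div_tally x (· ∉ H) hn
    rw [← hM] at h1 h3
    rw [hY, compensated_eq]
    linarith
  have hT0 : 0 ≤ T := tsum_nonneg fun _ => by positivity
  obtain ⟨l, hl⟩ := hconv ⟨2 * harmonicSum r + 2 * T, by
    rintro _ ⟨n, rfl⟩
    rcases le_total r n with hn | hn
    · linarith [hbound n hn, harmonicSum_nonneg n]
    · have : Y n = 0 := by simp [hY, compensated, Finset.Ico_eq_empty_of_le hn]
      linarith [harmonicSum_nonneg r]⟩
  refine not_tendsto_nhds_of_tendsto_atBot ?_ l hl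
  refine tendsto_atBot_mono' _ ((eventually_ge_atTop r).mono hbound) ?_
  exact tendsto_atBot_add_const_left _ _ (tendsto_neg_atTop_atBot.comp tendsto_harmonicSum_atTop)

/-- The set of labels that occur is stable under left multiplication by frequent labels. -/
lemma exists_eq_mul {y z : G}
    (hconv : ConvergesOfBddAbove
      (compensated x (fun _ a => if a = y * z then (1 : ℝ) else 0) r))
    (hy : ¬ Summable fun k : ℕ => (tally x (· = y) k : ℝ) / (k : ℝ) ^ 2)
    (hz : ∃ i, x i = z) : ∃ i, x i = y * z := by
  by_contra! hno
  obtain ⟨i, hi⟩ := hz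
  have hYn : ∀ n, compensated x (fun _ a => if a = y * z then (1 : ℝ) else 0) r n =
      - ∑ k ∈ Finset.Ico r n, drawProb x k (y * z) := by
    intro n
    simp [compensated_eq, hno]
  obtain ⟨l, hl⟩ := hconv ⟨0, by
    rintro _ ⟨n, rfl⟩
    simp only [hYn]
    exact neg_nonpos.2 (Finset.sum_nonneg fun _ _ => drawProb_nonneg _ _ _)⟩
  obtain ⟨b, hb⟩ := hl.bddBelow_range
  have hsum : Summable fun k => drawProb x (k + r) (y * z) := by
    refine summable_of_sum_range_le (c := -b) (fun _ => drawProb_nonneg _ _ _) fun n => ?_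
    have := hb ⟨n + r, rfl⟩
    simp only [hYn, Finset.sum_Ico_eq_sum_range, Nat.add_sub_cancel] at this
    simp_rw [add_comm _ r]
    linarith
  rw [summable_nat_add_iff (f := fun k => drawProb x k (y * z))] at hsum
  refine hy ((summable_nat_add_iff (i + 1)).1 (Summable.of_nonneg_of_le (fun _ => by positivity)
    (fun k => ?_) ((summable_nat_add_iff (i + 1)).2 hsum)))
  refine le_trans ?_ (tally_mul_tally_le_drawProb x (k + (i + 1)) y z)
  have h1 : (1 : ℝ) ≤ tally x (· = z) (k + (i + 1)) := by
    exact_mod_cast one_le_tally (by omega) hi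
  gcongr
  exact le_mul_of_one_le_right (by positivity) h1

lemma forall_exists_eq_of_convergence {g : Fin r → G}
    (hgen : Subgroup.closure (Set.range g) = ⊤) (hinit : ∀ i : Fin r, x i = g i)
    (hsub : ∀ H : Subgroup G, ∀ _ : DecidablePred (· ∉ H),
      ConvergesOfBddAbove (compensated x
        (fun k a => (if a ∉ H then (1 : ℝ) else 0) / tally x (· ∉ H) k) r))
    (helt : ∀ b : G, ConvergesOfBddAbove
      (compensated x (fun _ a => if a = b then (1 : ℝ) else 0) r)) (a : G) :
    ∃ i, x i = a := by
  classical
  set R : Set G := {y | ¬ Summable fun k : ℕ => (tally x (· = y) k : ℝ) / (k : ℝ) ^ 2} with hR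
  set H := Subgroup.closure R with hH
  have htop : H = ⊤ := by
    by_contra hne
    have hex : ∃ i, g i ∉ H := by
      by_contra! hall
      refine hne (top_le_iff.1 ?_)
      rw [← hgen, Subgroup.closure_le]
      rintro _ ⟨i, rfl⟩
      exact hall i
    obtain ⟨i, hi⟩ := hex
    refine not_summable_tally_notMem (one_le_tally i.2 (by rwa [hinit])) (hsub H inferInstance) ?_
    have hdecomp : ∀ k, (tally x (· ∉ H) k : ℝ) =
        ∑ y, tally x (· = y) k * if y ∉ H then (1 : ℝ) else 0 := fun k => by
      rw [tally_eq_sum, sum_comp_eq_sum_tally x fun y => if y ∉ H then (1 : ℝ) else 0]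
    simp_rw [hdecomp, Finset.sum_div]
    refine summable_sum fun y _ => ?_
    by_cases hy : y ∈ H
    · simp [hy, summable_zero]
    · have : y ∉ R := fun h => hy (Subgroup.subset_closure h)
      simpa [hy, hR] using this
  have hmem : ∀ y ∈ Submonoid.closure R, ∀ z, (∃ i, x i = z) → ∃ i, x i = y * z := by
    intro y hy
    induction hy using Submonoid.closure_induction with
    | mem y hy => exact fun z hz => exists_eq_mul (helt (y * z)) hy hz
    | one => simp
    | mul y y' _ _ h h' => exact fun z hz => by simpa [mul_assoc] using h _ (h' z hz)
  have ha : a * (x 0)⁻¹ ∈ Submonoid.closure R := by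
    rw [← Subgroup.closure_toSubmonoid_of_finite, ← hH, htop]
    trivial
  simpa using hmem _ ha (x 0) ⟨0, rfl⟩

end Support

section Lyapunov

variable {G : Type*} [Group G] [Fintype G]

/-- The drift of the Lyapunov function of the urn at the distribution `q`, up to `card G`. -/
noncomputable def dissipation (q : G → ℝ) : ℝ := ∑ y, q y * ∑ z, q z / q (y * z)

lemma sum_ratio_sub_one_sub_log {q : G → ℝ} (hq : ∀ a, 0 < q a) (y : G) :
    ∑ z, (q z / q (y * z) - 1 - Real.log (q z / q (y * z))) =
      ∑ z, q z / q (y * z) - Fintype.card G := by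
  have : ∑ z, Real.log (q z / q (y * z)) = 0 := by
    simp_rw [Real.log_div (hq _).ne' (hq _).ne', Finset.sum_sub_distrib]
    rw [sub_eq_zero]
    exact (Equiv.sum_comp (Equiv.mulLeft y) fun z => Real.log (q z)).symm
  rw [Finset.sum_sub_distrib, this, Finset.sum_sub_distrib]
  simp

lemma card_le_sum_ratio {q : G → ℝ} (hq : ∀ a, 0 < q a) (y : G) :
    (Fintype.card G : ℝ) ≤ ∑ z, q z / q (y * z) := by
  rw [← sub_nonneg, ← sum_ratio_sub_one_sub_log hq]
  exact Finset.sum_nonneg fun z _ => sub_nonneg.2 <|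
    Real.log_le_sub_one_of_pos (div_pos (hq _) (hq _))

lemma card_le_dissipation {q : G → ℝ} (hq : ∀ a, 0 < q a) (h1 : ∑ a, q a = 1) :
    (Fintype.card G : ℝ) ≤ dissipation q := by
  calc (Fintype.card G : ℝ) = ∑ y, q y * Fintype.card G := by rw [← Finset.sum_mul, h1, one_mul]
    _ ≤ _ := Finset.sum_le_sum fun y _ =>
      mul_le_mul_of_nonneg_left (card_le_sum_ratio hq y) (hq y).le

lemma eq_uniform_of_dissipation_eq {q : G → ℝ} (hq : ∀ a, 0 < q a) (h1 : ∑ a, q a = 1)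
    (h : dissipation q = Fintype.card G) (a : G) : q a = 1 / Fintype.card G := by
  have hy : ∀ y, ∑ z, q z / q (y * z) = Fintype.card G := by
    have h0 : ∑ y, q y * (∑ z, q z / q (y * z) - Fintype.card G) = 0 := by
      simp_rw [mul_sub, Finset.sum_sub_distrib]
      rw [← Finset.sum_mul, h1, one_mul, ← h, dissipation, sub_self]
    intro y
    have := (Finset.sum_eq_zero_iff_of_nonneg fun y _ =>
      mul_nonneg (hq y).le (sub_nonneg.2 (card_le_sum_ratio hq y))).1 h0 y (Finset.mem_univ y)
    exact sub_eq_zero.1 ((mul_eq_zero.1 this).resolve_left (hq y).ne')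
  have hconst : ∀ y z, q z = q (y * z) := by
    intro y z
    have h0 := sum_ratio_sub_one_sub_log hq y
    rw [hy, sub_self] at h0
    have hz := (Finset.sum_eq_zero_iff_of_nonneg fun z _ => sub_nonneg.2 <|
      Real.log_le_sub_one_of_pos (div_pos (hq z) (hq (y * z)))).1 h0 z (Finset.mem_univ z)
    by_contra hne
    have := Real.log_lt_sub_one_of_pos (div_pos (hq z) (hq (y * z)))
      fun h => hne ((div_eq_one_iff_eq (hq _).ne').1 h)
    linarith
  have hca : ∀ b, q b = q a := fun b => by simpa using hconst (a * b⁻¹) b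
  rw [eq_div_iff (by simp), mul_comm]
  simpa [hca] using h1

lemma eq_uniform_of_sum_log_eq {q : G → ℝ} (hq : ∀ a, 0 < q a) (h1 : ∑ a, q a = 1)
    (h : ∑ a, Real.log (q a) = ∑ _a : G, Real.log (1 / Fintype.card G)) (a : G) :
    q a = 1 / Fintype.card G := by
  set c : ℝ := (Fintype.card G : ℝ) with hc
  have hc0 : 0 < c := by simp [hc, Fintype.card_pos]
  have h0 : ∑ b, (c * q b - 1 - Real.log (c * q b)) = 0 := by
    have hl : ∑ b, Real.log (c * q b) = 0 := by
      simp_rw [Real.log_mul hc0.ne' (hq _).ne', Finset.sum_add_distrib, h]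
      simp
    rw [Finset.sum_sub_distrib, hl, Finset.sum_sub_distrib, ← Finset.mul_sum, h1]
    simp [hc]
  have ha := (Finset.sum_eq_zero_iff_of_nonneg fun b _ => sub_nonneg.2 <|
    Real.log_le_sub_one_of_pos (mul_pos hc0 (hq b))).1 h0 a (Finset.mem_univ a)
  by_contra hne
  have := Real.log_lt_sub_one_of_pos (mul_pos hc0 (hq a))
    fun h => hne (by rw [eq_div_iff hc0.ne', mul_comm]; exact h)
  linarith

lemma continuousAt_dissipation {q : G → ℝ} (hq : ∀ a, 0 < q a) : ContinuousAt dissipation q := by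
  unfold dissipation
  have hc : ∀ a : G, ContinuousAt (fun p : G → ℝ => p a) q := fun a =>
    (continuous_apply a).continuousAt
  exact tendsto_finsetSum _ fun y _ => (hc y).mul <|
    tendsto_finsetSum _ fun z _ => (hc z).div (hc (y * z)) (hq _).ne'

/-- Deterministic core: a sequence in the simplex, bounded away from the boundary, along which
`∑ log` converges and the dissipation comes arbitrarily close to its minimum, converges to the
uniform distribution. -/
lemma tendsto_uniform_of_lyapunov {p : ℕ → G → ℝ} {ε l : ℝ} (hε : 0 < ε)
    (hp : ∀ᶠ n in atTop, ∀ a, ε ≤ p n a) (hp1 : ∀ᶠ n in atTop, ∑ a, p n a = 1)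
    (hl : Tendsto (fun n => ∑ a, Real.log (p n a)) atTop (nhds l))
    (hd : ∀ η > 0, ∃ᶠ n in atTop, dissipation (p n) < Fintype.card G + η) :
    Tendsto p atTop (nhds fun _ => 1 / (Fintype.card G : ℝ)) := by
  set K : Set (G → ℝ) := Set.univ.pi fun _ => Set.Icc ε 1 with hK
  have hKc : IsCompact K := isCompact_univ_pi fun _ => isCompact_Icc
  have hmem : ∀ᶠ n in atTop, p n ∈ K := by
    filter_upwards [hp, hp1] with n h h1 a _
    refine ⟨h a, h1 ▸ Finset.single_le_sum (f := p n) (fun b _ => hε.le.trans (h b))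
      (Finset.mem_univ a)⟩
  have hlim : ∀ q ∈ K, ∀ φ : ℕ → ℕ, Tendsto φ atTop atTop → Tendsto (p ∘ φ) atTop (nhds q) →
      (∀ a, 0 < q a) ∧ ∑ a, q a = 1 ∧ ∑ a, Real.log (q a) = l := by
    intro q hq φ hφ hpq
    have hq0 : ∀ a, 0 < q a := fun a => hε.trans_le (hq a trivial).1
    have hpa := tendsto_pi_nhds.1 hpq
    refine ⟨hq0, ?_, ?_⟩
    · refine tendsto_nhds_unique (tendsto_finsetSum _ fun a _ => hpa a) ?_
      refine tendsto_const_nhds.congr' ?_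
      filter_upwards [hφ.eventually hp1] with n hn using hn.symm
    · exact tendsto_nhds_unique (tendsto_finsetSum _ fun a _ => (hpa a).log (hq0 a).ne')
        (hl.comp hφ)
  have hluni : l = ∑ _a : G, Real.log (1 / Fintype.card G) := by
    obtain ⟨φ, hφ, hφd⟩ := extraction_forall_of_frequently
      (P := fun n k => dissipation (p k) < Fintype.card G + 1 / ((n : ℝ) + 1) ∧ p k ∈ K ∧
        ∑ a, p k a = 1)
      fun n => (hd _ (by positivity)).and_eventually (hmem.and hp1)
    obtain ⟨q, hq, ψ, hψ, hpq⟩ := hKc.tendsto_subseq fun n => (hφd n).2.1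
    obtain ⟨hq0, hq1, hql⟩ := hlim q hq (φ ∘ ψ) (hφ.tendsto_atTop.comp hψ.tendsto_atTop) hpq
    have hdq : dissipation q = Fintype.card G := by
      refine tendsto_nhds_unique ((continuousAt_dissipation hq0).tendsto.comp hpq) ?_
      have hz : Tendsto (fun n : ℕ => (Fintype.card G : ℝ) + 1 / (((ψ n : ℕ) : ℝ) + 1)) atTop
          (nhds (Fintype.card G)) := by
        simpa using (tendsto_one_div_add_atTop_nhds_zero_nat.comp hψ.tendsto_atTop).const_add
          (Fintype.card G : ℝ)
      exact tendsto_of_tendsto_of_tendsto_of_le_of_le tendsto_const_nhds hz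
        (fun n => card_le_dissipation (fun a => hε.trans_le ((hφd (ψ n)).2.1 a trivial).1)
          (hφd (ψ n)).2.2)
        fun n => (hφd (ψ n)).1.le
    rw [← hql]
    simp_rw [eq_uniform_of_dissipation_eq hq0 hq1 hdq]
  refine hKc.tendsto_nhds_of_unique_mapClusterPt hmem fun q hq hcl => ?_
  obtain ⟨ψ, hψ, hpq⟩ := hcl.tendsto_subseq
  obtain ⟨hq0, hq1, hql⟩ := hlim q hq ψ hψ.tendsto_atTop hpq
  exact funext (eq_uniform_of_sum_log_eq hq0 hq1 (hql.trans hluni))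

variable [DecidableEq G] {x : ℕ → G} {r : ℕ}

lemma sum_drawProb_div_tally {n : ℕ} (hn : n ≠ 0) :
    ∑ a, 1 / (tally x (· = a) n : ℝ) * drawProb x n a =
      dissipation (fun a => (tally x (· = a) n : ℝ) / n) * (n : ℝ)⁻¹ := by
  have hn' : (n : ℝ) ≠ 0 := by exact_mod_cast hn
  rw [sum_mul_drawProb_eq_sum_tally, dissipation, Finset.sum_div, Finset.sum_mul]
  refine Finset.sum_congr rfl fun y _ => ?_
  simp_rw [div_div_div_cancel_right₀ hn', mul_one_div]
  field_simp

/-- The nonnegative potential `∑_a (h n - h (N_a n))`, with `h` the harmonic sum. -/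
noncomputable def potential (x : ℕ → G) (n : ℕ) : ℝ :=
  ∑ a, (harmonicSum n - harmonicSum (tally x (· = a) n))

omit [Group G] in
lemma sum_Ico_one_div_tally {m n : ℕ} (h : m ≤ n) :
    ∑ k ∈ Finset.Ico m n, 1 / (tally x (· = x k) k : ℝ) =
      Fintype.card G * (harmonicSum n - harmonicSum m) - (potential x n - potential x m) := by
  have h1 : ∀ k, 1 / (tally x (· = x k) k : ℝ) =
      ∑ a, (if x k = a then (1 : ℝ) else 0) / tally x (· = a) k := fun k => by
    simp [ite_div]
  simp_rw [h1]
  rw [Finset.sum_comm, Finset.sum_congr rfl fun a _ => sum_Ico_div_tally x (· = a) h]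
  simp_rw [potential, Finset.sum_sub_distrib]
  simp
  ring

lemma compensated_eq_potential {m n : ℕ} (hm : m ≠ 0) (hrm : r ≤ m) (hmn : m ≤ n) :
    compensated x (fun k a => 1 / (tally x (· = a) k : ℝ)) r n =
      compensated x (fun k a => 1 / (tally x (· = a) k : ℝ)) r m + potential x m
        - potential x n - ∑ k ∈ Finset.Ico m n,
          (dissipation (fun a => (tally x (· = a) k : ℝ) / k) - Fintype.card G) * (k : ℝ)⁻¹ := by
  have hd : ∑ k ∈ Finset.Ico m n, ∑ a, 1 / (tally x (· = a) k : ℝ) * drawProb x k a =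
      ∑ k ∈ Finset.Ico m n, dissipation (fun a => (tally x (· = a) k : ℝ) / k) * (k : ℝ)⁻¹ :=
    Finset.sum_congr rfl fun k hk => sum_drawProb_div_tally (by grind)
  have h1 := Finset.sum_Ico_consecutive (fun k => 1 / (tally x (· = x k) k : ℝ)) hrm hmn
  have h2 := Finset.sum_Ico_consecutive
    (fun k => ∑ a, 1 / (tally x (· = a) k : ℝ) * drawProb x k a) hrm hmn
  rw [sum_Ico_one_div_tally hmn] at h1
  rw [hd] at h2
  rw [compensated_eq, compensated_eq, ← h1, ← h2]
  simp_rw [sub_mul, Finset.sum_sub_distrib, ← Finset.mul_sum, sum_Ico_inv hmn]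
  ring

lemma tendsto_tally_div_of_convergence (hall : ∀ a, ∃ i, x i = a)
    (hconv : ConvergesOfBddAbove
      (compensated x (fun k a => 1 / (tally x (· = a) k : ℝ)) r)) (a : G) :
    Tendsto (fun n => (tally x (· = a) n : ℝ) / n) atTop (nhds (1 / (Fintype.card G : ℝ))) := by
  set p : ℕ → G → ℝ := fun n a => (tally x (· = a) n : ℝ) / n with hp
  set Y := compensated x (fun k a => 1 / (tally x (· = a) k : ℝ)) r with hY
  obtain ⟨m, hm0, hrm, hm⟩ : ∃ m, m ≠ 0 ∧ r ≤ m ∧ ∀ n, m ≤ n → ∀ a, 0 < tally x (· = a) n := by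
    choose i hi using hall
    refine ⟨r + 1 + ∑ a, i a, by omega, by omega, fun n hn a => one_le_tally ?_ (hi a)⟩
    have := Finset.single_le_sum (f := i) (fun _ _ => Nat.zero_le _) (Finset.mem_univ a)
    omega
  have hpos : ∀ n, m ≤ n → ∀ a, 0 < p n a := fun n hn a =>
    div_pos (by exact_mod_cast hm n hn a) (by exact_mod_cast (by omega : 0 < n))
  have hp1 : ∀ n, m ≤ n → ∑ a, p n a = 1 := fun n hn => sum_tally_div x (by omega)
  set D : ℕ → ℝ := fun k => (dissipation (p k) - Fintype.card G) * (k : ℝ)⁻¹ with hD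
  have hD0 : ∀ k, m ≤ k → 0 ≤ D k := fun k hk =>
    mul_nonneg (sub_nonneg.2 (card_le_dissipation (hpos k hk) (hp1 k hk))) (by positivity)
  have hYn : ∀ n, m ≤ n → Y n = Y m + potential x m - potential x n - ∑ k ∈ Finset.Ico m n, D k :=
    fun n hn => compensated_eq_potential hm0 hrm hn
  have hpot : ∀ n, 0 ≤ potential x n := fun n =>
    Finset.sum_nonneg fun a _ => harmonicSum_sub_harmonicSum_tally_nonneg x (· = a) n
  have hDs : ∀ n, 0 ≤ ∑ k ∈ Finset.Ico m n, D k := fun n =>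
    Finset.sum_nonneg fun k hk => hD0 k (Finset.mem_Ico.1 hk).1
  obtain ⟨l, hl⟩ := hconv (IsBoundedUnder.bddAbove_range ⟨Y m + potential x m, by
    rw [eventually_map]
    filter_upwards [eventually_ge_atTop m] with n hn
    linarith [hYn n hn, hpot n, hDs n]⟩)
  have hDsum : Summable fun k => D (k + m) := by
    obtain ⟨b, hb⟩ := hl.bddBelow_range
    refine summable_of_sum_range_le (c := Y m + potential x m - b)
      (fun k => hD0 _ (Nat.le_add_left _ _)) fun n => ?_
    have h1 := hb ⟨n + m, rfl⟩
    have h2 := hYn (n + m) (Nat.le_add_left _ _)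
    rw [Finset.sum_Ico_eq_sum_range, Nat.add_sub_cancel] at h2
    simp_rw [add_comm _ m] at h1 h2 ⊢
    linarith [hpot (m + n)]
  obtain ⟨L, hL⟩ : ∃ L, Tendsto (potential x) atTop (nhds L) := by
    refine ⟨Y m + potential x m - l - ∑' k, D (k + m), (tendsto_add_atTop_iff_nat m).1 ?_⟩
    refine (((tendsto_add_atTop_iff_nat m).2 hl).const_sub (Y m + potential x m)).sub
      hDsum.hasSum.tendsto_sum_nat |>.congr fun n => ?_
    have h2 := hYn (n + m) (Nat.le_add_left _ _)
    rw [Finset.sum_Ico_eq_sum_range, Nat.add_sub_cancel] at h2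
    simp_rw [add_comm _ m] at h2 ⊢
    linarith
  have hlogp : ∀ n, m ≤ n → ∀ a, Real.log (p n a) = (harmonicSum n - Real.log n) -
      (harmonicSum (tally x (· = a) n) - Real.log (tally x (· = a) n)) -
      (harmonicSum n - harmonicSum (tally x (· = a) n)) := by
    intro n hn a
    have h1 : (tally x (· = a) n : ℝ) ≠ 0 := by exact_mod_cast (hm n hn a).ne'
    have h2 : (n : ℝ) ≠ 0 := by exact_mod_cast (by omega : n ≠ 0)
    rw [hp, Real.log_div h1 h2]
    ring
  obtain ⟨ε, hε, hpε⟩ : ∃ ε > 0, ∀ n, m ≤ n → ∀ a, ε ≤ p n a := by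
    obtain ⟨B, hB⟩ := hL.bddAbove_range
    obtain ⟨u, hu⟩ := tendsto_harmonicSum_sub_log.bddAbove_range
    obtain ⟨v, hv⟩ := tendsto_harmonicSum_sub_log.bddBelow_range
    refine ⟨Real.exp (v - u - B), Real.exp_pos _, fun n hn a => ?_⟩
    rw [← Real.le_log_iff_exp_le (hpos n hn a), hlogp n hn a]
    have h1 := hB ⟨n, rfl⟩
    have h2 := Finset.single_le_sum (fun a _ => harmonicSum_sub_harmonicSum_tally_nonneg x (· = a) n)
      (Finset.mem_univ a)
    have h3 := hv ⟨n, rfl⟩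
    have h4 := hu ⟨tally x (· = a) n, rfl⟩
    rw [← potential] at h2
    simp only at h3 h4
    linarith
  have htop : ∀ a, Tendsto (tally x (· = a)) atTop atTop := fun a => by
    rw [← tendsto_natCast_atTop_iff (R := ℝ)]
    refine tendsto_atTop_mono' _ ?_
      (tendsto_natCast_atTop_atTop (R := ℝ) |>.const_mul_atTop hε)
    filter_upwards [eventually_ge_atTop m] with n hn
    exact (le_div_iff₀ (by exact_mod_cast (by omega : 0 < n))).1 (hpε n hn a)
  refine tendsto_pi_nhds.1 (tendsto_uniform_of_lyapunov (p := p) (l := -L) hε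
    ((eventually_ge_atTop m).mono hpε) ((eventually_ge_atTop m).mono hp1) ?_ ?_) a
  · have h : Tendsto (fun n : ℕ => ∑ a, ((harmonicSum n - Real.log n) -
        (harmonicSum (tally x (· = a) n) - Real.log (tally x (· = a) n))) - potential x n)
        atTop (nhds (∑ _a : G, (Real.eulerMascheroniConstant - Real.eulerMascheroniConstant)
          - L)) :=
      (tendsto_finsetSum _ fun a _ => tendsto_harmonicSum_sub_log.sub
        (tendsto_harmonicSum_sub_log.comp (htop a))).sub hL
    simp only [sub_self, Finset.sum_const_zero, zero_sub] at h
    refine h.congr' ?_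
    filter_upwards [eventually_ge_atTop m] with n hn
    rw [potential, ← Finset.sum_sub_distrib]
    exact Finset.sum_congr rfl fun a _ => (hlogp n hn a).symm
  · intro η hη
    by_contra hev
    rw [not_frequently] at hev
    refine Real.not_summable_natCast_inv ?_
    have hDsum' : Summable D := (summable_nat_add_iff m).1 hDsum
    refine Summable.of_norm_bounded_eventually_nat (hDsum'.mul_left η⁻¹) ?_
    filter_upwards [hev] with n hn
    rw [Real.norm_of_nonneg (by positivity), hD, ← mul_assoc]
    refine le_mul_of_one_le_left (by positivity) ?_
    rw [inv_mul_eq_div, one_le_div hη]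
    linarith [not_lt.1 hn]

end Lyapunov

end DiaconisUrn

open DiaconisUrn

theorem diaconis_urn_converges_to_uniform
    {G : Type*} [Group G] [Fintype G] [DecidableEq G]
    [MeasurableSpace G] [MeasurableSingletonClass G]
    {Ω : Type*} {m0 : MeasurableSpace Ω} {μ : Measure Ω} [IsProbabilityMeasure μ]
    (r : ℕ) (hr : 1 ≤ r) (g : Fin r → G)
    (hgen : Subgroup.closure (Set.range g) = ⊤)
    (X : ℕ → Ω → G) (hXmeas : ∀ k, Measurable (X k))
    -- the initial r balls are labeled by the generators
    (hinit : ∀ i : Fin r, ∀ ω : Ω, X (i : ℕ) ω = g i)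
    -- given the first n balls (n ≥ r), the label of the new ball is the product of
    -- the labels of two balls drawn uniformly with replacement from the urn
    (hcond : ∀ n, r ≤ n → ∀ a : G,
      μ[(fun ω => if X n ω = a then (1 : ℝ) else 0) |
          MeasurableSpace.comap (fun ω (i : Fin n) => X (i : ℕ) ω) inferInstance]
        =ᵐ[μ] fun ω =>
          (∑ i : Fin n, ∑ j : Fin n,
            if X (i : ℕ) ω * X (j : ℕ) ω = a then (1 : ℝ) else 0) / (n : ℝ) ^ 2) :
    ∀ᵐ ω ∂μ, ∀ a : G,
      Tendsto
        (fun n => (((Finset.range n).filter (fun k => X k ω = a)).card : ℝ) / (n : ℝ))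
        atTop (nhds (1 / (Fintype.card G : ℝ))) := by
  classical
  have habs : ∀ (q : Prop) [Decidable q] (k : ℕ), |(if q then (1 : ℝ) else 0) / k| ≤ 1 := by
    intro q _ k
    split_ifs
    · rw [abs_of_nonneg (by positivity), one_div]
      exact Nat.cast_inv_le_one k
    · simp
  have hsub : ∀ᵐ ω ∂μ, ∀ H : Subgroup G, ConvergesOfBddAbove (compensated (fun k => X k ω)
      (fun k a => (if a ∉ H then (1 : ℝ) else 0) / tally (fun k => X k ω) (· ∉ H) k) r) :=
    ae_all_iff.2 fun H => ae_convergesOfBddAbove_compensated hXmeas hcond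
      (fun x k a => (if a ∉ H then (1 : ℝ) else 0) / tally x (· ∉ H) k)
      (fun x y n h => by simp_rw [tally_congr (· ∉ H) h]) fun x n a => habs _ _
  have helt : ∀ᵐ ω ∂μ, ∀ b : G, ConvergesOfBddAbove (compensated (fun k => X k ω)
      (fun _ a => if a = b then (1 : ℝ) else 0) r) :=
    ae_all_iff.2 fun b => ae_convergesOfBddAbove_compensated hXmeas hcond
      (fun _ _ a => if a = b then (1 : ℝ) else 0) (fun x y n h => rfl)
      fun x n a => by simpa using habs (a = b) 1
  have hmain : ∀ᵐ ω ∂μ, ConvergesOfBddAbove (compensated (fun k => X k ω)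
      (fun k a => 1 / (tally (fun k => X k ω) (· = a) k : ℝ)) r) :=
    ae_convergesOfBddAbove_compensated hXmeas hcond
      (fun x k a => 1 / (tally x (· = a) k : ℝ))
      (fun x y n h => by ext a; rw [tally_congr (· = a) h]) fun x n a => by
        simpa using habs True (tally x (· = a) n)
  filter_upwards [hsub, helt, hmain] with ω h1 h2 h3 a
  refine tendsto_tally_div_of_convergence (forall_exists_eq_of_convergence hgen
    (fun i => hinit i ω) (fun H _ => ?_) h2) h3 a
  convert h1 H
end

section
/- In the mod-2 urn model where the urn starts with one ball labeled 0 and one ball labeled 1, and at each step k ≥ 2 balls are drawn uniformly with replacement and a new ball labeled by the parity (sum mod 2) of the drawn labels is added, the fraction p_n of balls labeled 1 converges to 1/2 almost surely as n → ∞. -/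
open MeasureTheory Filter

/-- A nonnegative process `V` whose conditional increments are at most `-g`, with `g` nonnegative,
converges almost surely, and `g` is almost surely summable. -/
theorem ae_tendsto_and_summable_of_condExp_add_le {Ω : Type*} {m0 : MeasurableSpace Ω}
    {μ : Measure Ω} [IsFiniteMeasure μ] {ℱ : Filtration ℕ m0} {V g : ℕ → Ω → ℝ}
    (hVadp : StronglyAdapted ℱ V) (hgadp : StronglyAdapted ℱ g)
    (hVint : ∀ n, Integrable (V n) μ) (hgint : ∀ n, Integrable (g n) μ)
    (hV : ∀ n ω, 0 ≤ V n ω) (hg : ∀ n ω, 0 ≤ g n ω)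
    (hstep : ∀ n, μ[V (n + 1) | ℱ n] + g n ≤ᵐ[μ] V n) :
    ∀ᵐ ω ∂μ, (∃ L, Tendsto (fun n => V n ω) atTop (nhds L)) ∧ Summable (fun n => g n ω) := by
  set Z : ℕ → Ω → ℝ := fun n => V n + ∑ i ∈ Finset.range n, g i with hZ
  have hSadp : ∀ n m, n ≤ m + 1 → StronglyMeasurable[ℱ m] (∑ i ∈ Finset.range n, g i) :=
    fun n m hnm => Finset.stronglyMeasurable_sum _ fun i hi =>
      (hgadp i).mono (ℱ.mono (by have := Finset.mem_range.1 hi; omega))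
  have hSint : ∀ n, Integrable (∑ i ∈ Finset.range n, g i) μ :=
    fun n => integrable_finsetSum' _ fun i _ => hgint i
  have hZint : ∀ n, Integrable (Z n) μ := fun n => (hVint n).add (hSint n)
  have hZnonneg : ∀ n ω, 0 ≤ Z n ω := fun n ω => by
    simp only [hZ, Pi.add_apply, Finset.sum_apply]
    exact add_nonneg (hV n ω) (Finset.sum_nonneg fun i _ => hg i ω)
  have hsuper : Supermartingale Z ℱ μ := by
    refine supermartingale_nat (fun n => (hVadp n).add (hSadp n n (by omega))) hZint fun n => ?_
    have hsplit : μ[Z (n + 1) | ℱ n] =ᵐ[μ]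
        μ[V (n + 1) | ℱ n] + ∑ i ∈ Finset.range (n + 1), g i := by
      refine (condExp_add (hVint _) (hSint _) _).trans ?_
      rw [condExp_of_stronglyMeasurable (ℱ.le n) (hSadp (n + 1) n le_rfl) (hSint _)]
    filter_upwards [hsplit, hstep n] with ω h₁ h₂
    rw [h₁]
    simp only [hZ, Pi.add_apply, Finset.sum_apply, Finset.sum_range_succ] at h₂ ⊢
    linarith
  have hbdd : ∀ n, eLpNorm ((-Z) n) 1 μ ≤ ((∫ ω, Z 0 ω ∂μ).toNNReal : ENNReal) := fun n => by
    rw [Pi.neg_apply, eLpNorm_neg, eLpNorm_one_eq_lintegral_enorm,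
      ← ofReal_integral_norm_eq_lintegral_enorm (hZint n)]
    refine ENNReal.ofReal_le_ofReal ?_
    simp only [Real.norm_of_nonneg (hZnonneg n _)]
    simpa using hsuper.setIntegral_le (Nat.zero_le n) MeasurableSet.univ
  filter_upwards [hsuper.neg.exists_ae_tendsto_of_bdd hbdd] with ω ⟨c, hc⟩
  have hlim : Tendsto (fun n => Z n ω) atTop (nhds (-c)) := by simpa using hc.neg
  obtain ⟨M, hM⟩ := hlim.bddAbove_range
  have hsum : Summable (fun n => g n ω) :=
    summable_of_sum_range_le (c := M) (hg · ω) fun n => by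
      have := hM ⟨n, rfl⟩
      simp only [hZ, Pi.add_apply, Finset.sum_apply] at this
      linarith [hV n ω]
  refine ⟨⟨_, (hlim.sub hsum.hasSum.tendsto_sum_nat).congr fun n => ?_⟩, hsum⟩
  simp [hZ]

/-- The Lyapunov function for an urn with `a` balls labeled `1` and `b` balls labeled `0`. -/
noncomputable def urnPotential (a b : ℝ) : ℝ := (a + b) ^ 2 / (a * b)

/-- The normalized difference of the two label counts. -/
noncomputable def urnBias (a b : ℝ) : ℝ := (b - a) / (a + b)

theorem urnPotential_comm (a b : ℝ) : urnPotential a b = urnPotential b a := by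
  unfold urnPotential; ring

theorem urnBias_swap (a b : ℝ) : urnBias a b = -urnBias b a := by
  unfold urnBias; ring

theorem urnPotential_eq {a b : ℝ} (ha : 0 < a) (hb : 0 < b) :
    urnPotential a b * (1 - urnBias a b ^ 2) = 4 := by
  unfold urnPotential urnBias; field_simp; ring

theorem urnPotential_succ_le {a b : ℝ} (ha : 0 < a) (hab : a ≤ b) :
    urnPotential (a + 1) b ≤ urnPotential a (b + 1) := by
  unfold urnPotential
  have hb : 0 < b := ha.trans_le hab
  have : a + 1 + b = a + (b + 1) := by ring
  rw [this]
  refine div_le_div_of_nonneg_left (by positivity) (by positivity) ?_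
  nlinarith

theorem urnPotential_drift_sq {a b : ℝ} (ha : 1 ≤ a) (hab : a ≤ b) :
    (1 - urnBias a b ^ 2) / 2 * urnPotential (a + 1) b
      + (1 + urnBias a b ^ 2) / 2 * urnPotential a (b + 1) + 8 / (a + b + 1)
      + urnBias a b ^ 2 * (1 - urnBias a b ^ 2) / (a + b)
      ≤ urnPotential a b + 8 / (a + b) := by
  obtain ⟨u, rfl⟩ : ∃ u, a = 1 + u := ⟨a - 1, by ring⟩
  obtain ⟨t, rfl⟩ : ∃ t, b = 1 + u + t := ⟨b - (1 + u), by ring⟩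
  have hu : 0 ≤ u := by linarith
  have ht : 0 ≤ t := by linarith
  rw [← sub_nonneg]
  set n := 1 + u + (1 + u + t) with hn
  have hn0 : 0 < n := by positivity
  have key : urnPotential (1 + u) (1 + u + t) + 8 / n -
      ((1 - urnBias (1 + u) (1 + u + t) ^ 2) / 2 * urnPotential (1 + u + 1) (1 + u + t)
      + (1 + urnBias (1 + u) (1 + u + t) ^ 2) / 2 * urnPotential (1 + u) (1 + u + t + 1)
      + 8 / (n + 1)
      + urnBias (1 + u) (1 + u + t) ^ 2 * (1 - urnBias (1 + u) (1 + u + t) ^ 2) / n) =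
      (n ^ 7 * (n + 1) * (u + 2) * (u + t + 2)
        + 8 * n ^ 4 * (1 + u) * (1 + u + t) * (u + 2) * (u + t + 2)
        - 4 * (1 + u) ^ 2 * (1 + u + t) ^ 2 * (u + 2) * (u + t + 2) * (n + 1) * t ^ 2
        - 2 * (1 + u) ^ 2 * (1 + u + t) * n ^ 3 * (n + 1) ^ 3 * (u + t + 2)
        - ((1 + u) ^ 2 + (1 + u + t) ^ 2) * n ^ 3 * (n + 1) ^ 3 * (1 + u + t) * (u + 2)) /
      (n ^ 5 * (n + 1) * (1 + u) * (1 + u + t) * (u + 2) * (u + t + 2)) := by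
    have h₁ : urnPotential (1 + u) (1 + u + t) = n ^ 2 / ((1 + u) * (1 + u + t)) := rfl
    have h₂ : urnPotential (1 + u + 1) (1 + u + t) = (n + 1) ^ 2 / ((u + 2) * (1 + u + t)) := by
      unfold urnPotential; congr 1 <;> ring
    have h₃ : urnPotential (1 + u) (1 + u + t + 1) = (n + 1) ^ 2 / ((1 + u) * (u + t + 2)) := by
      unfold urnPotential; congr 1 <;> ring
    have h₄ : (1 - urnBias (1 + u) (1 + u + t) ^ 2) = 4 * (1 + u) * (1 + u + t) / n ^ 2 := by
      unfold urnBias; rw [← hn, div_pow, eq_div_iff (by positivity), sub_mul,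
        div_mul_cancel₀ _ (by positivity)]; rw [hn]; ring
    have h₅ : (1 + urnBias (1 + u) (1 + u + t) ^ 2) =
        2 * ((1 + u) ^ 2 + (1 + u + t) ^ 2) / n ^ 2 := by
      unfold urnBias; rw [← hn, div_pow, eq_div_iff (by positivity), add_mul,
        div_mul_cancel₀ _ (by positivity)]; rw [hn]; ring
    have h₆ : urnBias (1 + u) (1 + u + t) ^ 2 = t ^ 2 / n ^ 2 := by
      unfold urnBias; rw [← hn, div_pow]; ring
    rw [h₄, h₅, h₁, h₂, h₃, h₆]
    clear_value n
    field_simp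
    ring
  rw [key]
  refine div_nonneg ?_ (by positivity)
  rw [hn]
  ring_nf
  positivity

/-- One-step drift inequality: a new ball is labeled `1` with probability `(1 - s) / 2`. -/
theorem urnPotential_drift {a b s : ℝ} (ha : 1 ≤ a) (hb : 1 ≤ b) (hs : |s| ≤ urnBias a b ^ 2) :
    (1 - s) / 2 * urnPotential (a + 1) b + (1 + s) / 2 * urnPotential a (b + 1)
      + 8 / (a + b + 1) + urnBias a b ^ 2 * (1 - urnBias a b ^ 2) / (a + b)
      ≤ urnPotential a b + 8 / (a + b) := by
  wlog hab : a ≤ b generalizing a b s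
  · have := this (a := b) (b := a) (s := -s) hb ha
      (by rwa [abs_neg, urnBias_swap, neg_sq]) (le_of_not_ge hab)
    rw [urnBias_swap b a, neg_sq, urnPotential_comm b a, urnPotential_comm (b + 1) a,
      urnPotential_comm b (a + 1), add_comm b a] at this
    linarith
  · have h₁ := urnPotential_drift_sq ha hab
    have h₂ := urnPotential_succ_le (by linarith : 0 < a) hab
    nlinarith [(abs_le.1 hs).2]

/-- If the potential stabilizes and the weighted drift is summable, the urn balances. -/
theorem tendsto_urnBias_zero {a b : ℕ → ℝ} (ha : ∀ n, 1 ≤ a n) (hb : ∀ n, 1 ≤ b n)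
    {L : ℝ}
    (hL : Tendsto (fun n => urnPotential (a n) (b n)) atTop (nhds L))
    (hsum : Summable fun n : ℕ =>
      urnBias (a n) (b n) ^ 2 * (1 - urnBias (a n) (b n) ^ 2) / (n + 2)) :
    Tendsto (fun n => urnBias (a n) (b n)) atTop (nhds 0) := by
  have heq : ∀ n, urnPotential (a n) (b n) * (1 - urnBias (a n) (b n) ^ 2) = 4 := fun n =>
    urnPotential_eq (by linarith [ha n]) (by linarith [hb n])
  have hpos : ∀ n, 0 < urnPotential (a n) (b n) := fun n => by
    have := ha n; have := hb n; unfold urnPotential; positivity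
  have hge : ∀ n, 4 ≤ urnPotential (a n) (b n) := fun n => by
    nlinarith [heq n, mul_nonneg (hpos n).le (sq_nonneg (urnBias (a n) (b n)))]
  have hL4 : 4 ≤ L := ge_of_tendsto' hL hge
  have hsq : Tendsto (fun n => urnBias (a n) (b n) ^ 2) atTop (nhds (1 - 4 / L)) := by
    refine (tendsto_const_nhds.sub (tendsto_const_nhds.div hL (by linarith))).congr fun n => ?_
    have h₁ := heq n
    have h₂ := (hpos n).ne'
    simp only [Pi.div_apply]
    field_simp
    linarith
  have hzero : 1 - 4 / L = 0 := by
    by_contra hne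
    have hlt : 4 / L < 1 := by
      refine lt_of_le_of_ne ((div_le_one (by linarith)).2 hL4) fun h => hne (by linarith)
    have hlim := hsq.mul (tendsto_const_nhds (x := (1 : ℝ)).sub hsq)
    set c := (1 - 4 / L) * (1 - (1 - 4 / L)) with hc
    have hcpos : 0 < c := mul_pos (by linarith) (by rw [sub_sub_cancel]; positivity)
    have hev := hlim.eventually (lt_mem_nhds (half_lt_self hcpos))
    have hharm : Summable fun n : ℕ => c / 2 * (1 / ((n : ℝ) + 2)) := by
      refine Summable.of_norm_bounded_eventually_nat hsum ?_
      filter_upwards [hev] with n hn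
      rw [Real.norm_of_nonneg (by positivity), mul_one_div]
      gcongr
    rw [summable_mul_left_iff (by positivity)] at hharm
    refine Real.not_summable_one_div_natCast ((summable_nat_add_iff 2).1 ?_)
    simpa using hharm
  rw [hzero] at hsq
  have := hsq.sqrt
  simp only [Real.sqrt_sq_eq_abs, Real.sqrt_zero] at this
  exact tendsto_zero_iff_abs_tendsto_zero _ |>.2 this

/-- The proportion of `k`-tuples of labels with odd sum. -/
theorem sum_indicator_sum_eq_one {ι : Type*} [Fintype ι] (k : ℕ) (y : ι → ZMod 2) :
    (∑ v : Fin k → ι, if ∑ j, y (v j) = 1 then (1 : ℝ) else 0) =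
      ((Fintype.card ι : ℝ) ^ k - (∑ i, if y i = 1 then (-1 : ℝ) else 1) ^ k) / 2 := by
  have hmul : ∀ p q : ZMod 2, (if p + q = 1 then (-1 : ℝ) else 1) =
      (if p = 1 then (-1 : ℝ) else 1) * (if q = 1 then (-1 : ℝ) else 1) := by
    have hcases : ∀ p : ZMod 2, p = 0 ∨ p = 1 := by decide
    have htwo : (1 : ZMod 2) + 1 = 0 := by decide
    intro p q
    rcases hcases p with rfl | rfl <;> rcases hcases q with rfl | rfl <;> simp [htwo]
  have hprod : ∀ (s : Finset (Fin k)) (z : Fin k → ZMod 2),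
      (if ∑ j ∈ s, z j = 1 then (-1 : ℝ) else 1) = ∏ j ∈ s, if z j = 1 then (-1 : ℝ) else 1 := by
    intro s z
    induction s using Finset.cons_induction with
    | empty => simp
    | cons j s hj ih => rw [Finset.sum_cons, Finset.prod_cons, hmul, ih]
  rw [Fintype.sum_pow]
  simp_rw [← hprod]
  have hind : ∀ p : Prop, [Decidable p] →
      (if p then (1 : ℝ) else 0) = (1 - if p then (-1 : ℝ) else 1) / 2 := by
    intro p _; split_ifs <;> norm_num
  simp_rw [hind]
  rw [← Finset.sum_div, Finset.sum_sub_distrib]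
  simp

/-- The number of balls labeled `1` among the first `n`. -/
noncomputable def oneCount {Ω : Type*} (X : ℕ → Ω → ZMod 2) (n : ℕ) (ω : Ω) : ℝ :=
  ∑ i ∈ Finset.range n, if X i ω = 1 then 1 else 0

/-- The number of balls labeled `0` among the first `n`. -/
noncomputable def zeroCount {Ω : Type*} (X : ℕ → Ω → ZMod 2) (n : ℕ) (ω : Ω) : ℝ :=
  ∑ i ∈ Finset.range n, if X i ω = 1 then 0 else 1

section Counts

variable {Ω : Type*} {X : ℕ → Ω → ZMod 2}

theorem oneCount_add_zeroCount (n : ℕ) (ω : Ω) : oneCount X n ω + zeroCount X n ω = n := by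
  have : ∀ i, ((if X i ω = 1 then 1 else 0) + (if X i ω = 1 then 0 else 1) : ℝ) = 1 := by
    intro i; split_ifs <;> norm_num
  simp only [oneCount, zeroCount, ← Finset.sum_add_distrib, this]
  simp

theorem zeroCount_sub_oneCount (n : ℕ) (ω : Ω) :
    zeroCount X n ω - oneCount X n ω = ∑ i : Fin n, if X i ω = 1 then (-1 : ℝ) else 1 := by
  rw [Fin.sum_univ_eq_sum_range (fun i => if X i ω = 1 then (-1 : ℝ) else 1), zeroCount, oneCount,
    ← Finset.sum_sub_distrib]
  refine Finset.sum_congr rfl fun i _ => ?_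
  split_ifs <;> norm_num

theorem one_le_oneCount (h₁ : ∀ ω, X 1 ω = 1) (n : ℕ) (ω : Ω) : 1 ≤ oneCount X (n + 2) ω := by
  have := Finset.single_le_sum (f := fun i => if X i ω = 1 then (1 : ℝ) else 0)
    (fun i _ => by positivity) (Finset.mem_range.2 (by omega : 1 < n + 2))
  simpa only [oneCount, h₁, if_true] using this

theorem one_le_zeroCount (h₀ : ∀ ω, X 0 ω = 0) (n : ℕ) (ω : Ω) : 1 ≤ zeroCount X (n + 2) ω := by
  have := Finset.single_le_sum (f := fun i => if X i ω = 1 then (0 : ℝ) else 1)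
    (fun i _ => by positivity) (Finset.mem_range.2 (by omega : 0 < n + 2))
  simpa only [zeroCount, h₀, zero_ne_one, if_false] using this

theorem urnPotential_succ_eq (n : ℕ) (ω : Ω) :
    urnPotential (oneCount X (n + 1) ω) (zeroCount X (n + 1) ω) =
      urnPotential (oneCount X n ω) (zeroCount X n ω + 1) +
      (urnPotential (oneCount X n ω + 1) (zeroCount X n ω) -
        urnPotential (oneCount X n ω) (zeroCount X n ω + 1)) *
      (if X n ω = 1 then 1 else 0) := by
  simp only [oneCount, zeroCount, Finset.sum_range_succ]
  split_ifs <;> simp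

variable [MeasurableSpace (ZMod 2)] [MeasurableSingletonClass (ZMod 2)]

theorem measurable_oneCount {m : MeasurableSpace Ω} {n : ℕ} (hX : ∀ i < n, Measurable (X i)) :
    Measurable (oneCount X n) :=
  Finset.measurable_fun_sum _ fun i hi =>
    .ite (hX i (Finset.mem_range.1 hi) (measurableSet_singleton 1)) measurable_const
      measurable_const

theorem measurable_zeroCount {m : MeasurableSpace Ω} {n : ℕ} (hX : ∀ i < n, Measurable (X i)) :
    Measurable (zeroCount X n) :=
  Finset.measurable_fun_sum _ fun i hi =>
    .ite (hX i (Finset.mem_range.1 hi) (measurableSet_singleton 1)) measurable_const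
      measurable_const

end Counts

theorem measurable_urnPotential {Ω : Type*} {m : MeasurableSpace Ω} {a b : Ω → ℝ}
    (ha : Measurable a) (hb : Measurable b) : Measurable fun ω => urnPotential (a ω) (b ω) :=
  ((ha.add hb).pow_const 2).div (ha.mul hb)

theorem measurable_urnBias {Ω : Type*} {m : MeasurableSpace Ω} {a b : Ω → ℝ}
    (ha : Measurable a) (hb : Measurable b) : Measurable fun ω => urnBias (a ω) (b ω) :=
  (hb.sub ha).div (ha.add hb)

theorem urnPotential_nonneg {a b : ℝ} (ha : 1 ≤ a) (hb : 1 ≤ b) : 0 ≤ urnPotential a b := by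
  unfold urnPotential; positivity

theorem urnPotential_le {a b : ℝ} (ha : 1 ≤ a) (hb : 1 ≤ b) :
    urnPotential a b ≤ (a + b) ^ 2 :=
  div_le_self (by positivity) (one_le_mul_of_one_le_of_one_le ha hb)

theorem abs_urnBias_le_one {a b : ℝ} (ha : 1 ≤ a) (hb : 1 ≤ b) : |urnBias a b| ≤ 1 := by
  unfold urnBias
  rw [abs_div, abs_of_pos (by linarith : 0 < a + b), div_le_one (by linarith), abs_le]
  constructor <;> linarith

/-- The sigma-algebras generated by the first `n + 2` balls. -/
def urnFiltration [MeasurableSpace (ZMod 2)] {Ω : Type*} {m0 : MeasurableSpace Ω}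
    {X : ℕ → Ω → ZMod 2} (hX : ∀ n, Measurable (X n)) : Filtration ℕ m0 where
  seq n := MeasurableSpace.comap (fun ω (i : Fin (n + 2)) => X (i : ℕ) ω) inferInstance
  mono' n m hnm := by
    have : Measurable fun (y : Fin (m + 2) → ZMod 2) (i : Fin (n + 2)) =>
        y (Fin.castLE (by omega) i) := measurable_pi_lambda _ fun i => measurable_pi_apply _
    rintro _ ⟨s, hs, rfl⟩
    exact ⟨_, this hs, rfl⟩
  le' n := Measurable.comap_le (measurable_pi_lambda _ fun i : Fin (n + 2) => hX i)

theorem measurable_urnFiltration [MeasurableSpace (ZMod 2)] {Ω : Type*} {_ : MeasurableSpace Ω}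
    {X : ℕ → Ω → ZMod 2} (hX : ∀ n, Measurable (X n)) {n i : ℕ} (hi : i < n + 2) :
    Measurable[urnFiltration hX n] (X i) :=
  (measurable_pi_apply (⟨i, hi⟩ : Fin (n + 2))).comp
    (comap_measurable fun ω (i : Fin (n + 2)) => X (i : ℕ) ω)

theorem mod_two_urn_converges_to_half
    [MeasurableSpace (ZMod 2)] [MeasurableSingletonClass (ZMod 2)]
    {Ω : Type*} {m0 : MeasurableSpace Ω} {μ : Measure Ω} [IsProbabilityMeasure μ]
    (k : ℕ) (hk : 2 ≤ k)
    (X : ℕ → Ω → ZMod 2) (hXmeas : ∀ n, Measurable (X n))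
    -- the urn starts with one ball labeled 0 and one ball labeled 1
    (hinit0 : ∀ ω, X 0 ω = 0) (hinit1 : ∀ ω, X 1 ω = 1)
    -- given the first n balls (n ≥ 2), k balls are drawn uniformly with replacement
    -- and the new ball is labeled by the sum mod 2 of the drawn labels
    (hcond : ∀ n, 2 ≤ n →
      μ[(fun ω => if X n ω = 1 then (1 : ℝ) else 0) |
          MeasurableSpace.comap (fun ω (i : Fin n) => X (i : ℕ) ω) inferInstance]
        =ᵐ[μ] fun ω =>
          (∑ v : Fin k → Fin n,
            if (∑ j : Fin k, X ((v j : ℕ)) ω) = 1 then (1 : ℝ) else 0) / (n : ℝ) ^ k) :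
    ∀ᵐ ω ∂μ,
      Tendsto
        (fun n => (((Finset.range n).filter (fun m => X m ω = 1)).card : ℝ) / (n : ℝ))
        atTop (nhds (1 / 2)) := by
  set ℱ := urnFiltration hXmeas
  set A : ℕ → Ω → ℝ := fun n => oneCount X (n + 2) with hA
  set B : ℕ → Ω → ℝ := fun n => zeroCount X (n + 2) with hB
  have hA1 : ∀ n ω, 1 ≤ A n ω := fun n ω => one_le_oneCount hinit1 n ω
  have hB1 : ∀ n ω, 1 ≤ B n ω := fun n ω => one_le_zeroCount hinit0 n ω
  have hAB : ∀ n ω, A n ω + B n ω = n + 2 := fun n ω => by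
    simpa using oneCount_add_zeroCount (X := X) (n + 2) ω
  have hAm : ∀ n, Measurable[ℱ n] (A n) := fun n =>
    measurable_oneCount fun i hi => measurable_urnFiltration hXmeas hi
  have hBm : ∀ n, Measurable[ℱ n] (B n) := fun n =>
    measurable_zeroCount fun i hi => measurable_urnFiltration hXmeas hi
  set V : ℕ → Ω → ℝ := fun n ω => urnPotential (A n ω) (B n ω) + 8 / (n + 2) with hV
  set g : ℕ → Ω → ℝ := fun n ω =>
    urnBias (A n ω) (B n ω) ^ 2 * (1 - urnBias (A n ω) (B n ω) ^ 2) / (n + 2) with hg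
  have hVm : ∀ n, Measurable[ℱ n] (V n) := fun n =>
    (measurable_urnPotential (hAm n) (hBm n)).add_const _
  have hgm : ∀ n, Measurable[ℱ n] (g n) := fun n => by
    have := (measurable_urnBias (hAm n) (hBm n)).pow_const 2
    exact (this.mul (this.const_sub 1)).div_const _
  have hbias : ∀ n ω, |urnBias (A n ω) (B n ω)| ≤ 1 := fun n ω =>
    abs_urnBias_le_one (hA1 n ω) (hB1 n ω)
  have hsq : ∀ n ω, urnBias (A n ω) (B n ω) ^ 2 ≤ 1 := fun n ω => (sq_le_one_iff_abs_le_one _).2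
    (hbias n ω)
  have hV0 : ∀ n ω, 0 ≤ V n ω := fun n ω =>
    add_nonneg (urnPotential_nonneg (hA1 n ω) (hB1 n ω)) (by positivity)
  have hg0 : ∀ n ω, 0 ≤ g n ω := fun n ω =>
    div_nonneg (mul_nonneg (sq_nonneg _) (sub_nonneg.2 (hsq n ω))) (by positivity)
  have hVint : ∀ n, Integrable (V n) μ := fun n => by
    refine .of_bound ((hVm n).mono (ℱ.le n) le_rfl).aestronglyMeasurable
      (((n : ℝ) + 2) ^ 2 + 8 / (n + 2)) (ae_of_all _ fun ω => ?_)
    rw [Real.norm_of_nonneg (hV0 n ω), ← hAB n ω]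
    simp only [hV, ← hAB n ω]
    gcongr
    exact urnPotential_le (hA1 n ω) (hB1 n ω)
  have hgint : ∀ n, Integrable (g n) μ := fun n => by
    refine .of_bound ((hgm n).mono (ℱ.le n) le_rfl).aestronglyMeasurable
      (1 / ((n : ℝ) + 2)) (ae_of_all _ fun ω => ?_)
    rw [Real.norm_of_nonneg (hg0 n ω)]
    simp only [hg]
    gcongr
    nlinarith [hsq n ω, sq_nonneg (urnBias (A n ω) (B n ω))]
  have hstep : ∀ n, μ[V (n + 1) | ℱ n] + g n ≤ᵐ[μ] V n := fun n => by
    set I : Ω → ℝ := fun ω => if X (n + 2) ω = 1 then 1 else 0 with hI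
    set c : Ω → ℝ := fun ω => urnPotential (A n ω) (B n ω + 1) + 8 / (n + 3) with hc
    set d : Ω → ℝ := fun ω =>
      urnPotential (A n ω + 1) (B n ω) - urnPotential (A n ω) (B n ω + 1) with hd
    have hcm : Measurable[ℱ n] c :=
      (measurable_urnPotential (hAm n) ((hBm n).add_const 1)).add_const _
    have hdm : Measurable[ℱ n] d := (measurable_urnPotential ((hAm n).add_const 1) (hBm n)).sub
      (measurable_urnPotential (hAm n) ((hBm n).add_const 1))
    have hP₁ : ∀ ω, 0 ≤ urnPotential (A n ω + 1) (B n ω) ∧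
        urnPotential (A n ω + 1) (B n ω) ≤ ((n : ℝ) + 3) ^ 2 := fun ω => by
      have ha : 1 ≤ A n ω + 1 := by linarith [hA1 n ω]
      refine ⟨urnPotential_nonneg ha (hB1 n ω), (urnPotential_le ha (hB1 n ω)).trans_eq ?_⟩
      congr 1; linarith [hAB n ω]
    have hP₀ : ∀ ω, 0 ≤ urnPotential (A n ω) (B n ω + 1) ∧
        urnPotential (A n ω) (B n ω + 1) ≤ ((n : ℝ) + 3) ^ 2 := fun ω => by
      have hb : 1 ≤ B n ω + 1 := by linarith [hB1 n ω]
      refine ⟨urnPotential_nonneg (hA1 n ω) hb, (urnPotential_le (hA1 n ω) hb).trans_eq ?_⟩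
      congr 1; linarith [hAB n ω]
    have hdb : ∀ ω, ‖d ω‖ ≤ ((n : ℝ) + 3) ^ 2 := fun ω => by
      rw [Real.norm_eq_abs, abs_le]
      constructor <;> simp only [hd] <;> linarith [(hP₀ ω).1, (hP₀ ω).2, (hP₁ ω).1, (hP₁ ω).2]
    have hIint : Integrable I μ := by
      refine .of_bound (Measurable.ite (hXmeas _ (measurableSet_singleton 1)) measurable_const
        measurable_const).aestronglyMeasurable 1 (ae_of_all _ fun ω => ?_)
      simp only [hI]; split_ifs <;> simp
    have hcint : Integrable c μ := by
      refine .of_bound (hcm.mono (ℱ.le n) le_rfl).aestronglyMeasurable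
        (((n : ℝ) + 3) ^ 2 + 8 / (n + 3)) (ae_of_all _ fun ω => ?_)
      rw [Real.norm_of_nonneg (add_nonneg (hP₀ ω).1 (by positivity))]
      gcongr
      exact (hP₀ ω).2
    have hVeq : V (n + 1) = c + d * I := by
      funext ω
      have h := urnPotential_succ_eq (X := X) (n + 2) ω
      simp only [hV, hc, hd, hI, hA, hB, Pi.add_apply, Pi.mul_apply] at h ⊢
      rw [show n + 1 + 2 = n + 2 + 1 by ring, h]
      push_cast
      ring
    have hdI : Integrable (d * I) μ := hIint.bdd_mul
      (hdm.mono (ℱ.le n) le_rfl).aestronglyMeasurable (ae_of_all _ hdb)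
    have hcondI : μ[I | ℱ n] =ᵐ[μ] fun ω => (1 - urnBias (A n ω) (B n ω) ^ k) / 2 := by
      refine (hcond (n + 2) (by omega)).trans (.of_forall fun ω => ?_)
      beta_reduce
      rw [sum_indicator_sum_eq_one k fun i : Fin (n + 2) => X i ω, ← zeroCount_sub_oneCount]
      simp only [urnBias, hAB n ω, div_pow, Fintype.card_fin]
      push_cast
      field_simp
      rfl
    filter_upwards [hcondI, condExp_add hcint hdI (ℱ n),
      condExp_stronglyMeasurable_mul_of_bound (ℱ.le n) hdm.stronglyMeasurable hIint _
        (ae_of_all _ hdb)] with ω h₁ h₂ h₃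
    rw [Pi.add_apply, hVeq, h₂, Pi.add_apply, h₃, Pi.mul_apply, h₁,
      condExp_of_stronglyMeasurable (ℱ.le n) hcm.stronglyMeasurable hcint]
    have hs : |urnBias (A n ω) (B n ω) ^ k| ≤ urnBias (A n ω) (B n ω) ^ 2 := by
      rw [abs_pow, ← sq_abs (urnBias _ _)]
      exact pow_le_pow_of_le_one (abs_nonneg _) (hbias n ω) hk
    have hdrift := urnPotential_drift (hA1 n ω) (hB1 n ω) hs
    rw [hAB n ω, show (n : ℝ) + 2 + 1 = n + 3 by ring] at hdrift
    simp only [hc, hd, hg, hV]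
    linarith
  filter_upwards [ae_tendsto_and_summable_of_condExp_add_le
    (fun n => (hVm n).stronglyMeasurable) (fun n => (hgm n).stronglyMeasurable)
    hVint hgint hV0 hg0 hstep] with ω ⟨⟨L, hL⟩, hsum⟩
  have hrho : Tendsto (fun n : ℕ => (8 : ℝ) / (n + 2)) atTop (nhds 0) :=
    tendsto_const_nhds.div_atTop (tendsto_atTop_add_const_right _ _ tendsto_natCast_atTop_atTop)
  have hlim := tendsto_urnBias_zero (hA1 · ω) (hB1 · ω)
    ((hL.sub hrho).congr fun n => by simp only [hV]; ring) hsum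
  rw [← tendsto_add_atTop_iff_nat 2]
  have hhalf : Tendsto (fun n => (1 - urnBias (A n ω) (B n ω)) / 2) atTop (nhds (1 / 2)) := by
    simpa using (hlim.const_sub 1).div_const 2
  refine hhalf.congr fun n => ?_
  have hcard : (((Finset.range (n + 2)).filter (fun m => X m ω = 1)).card : ℝ) = A n ω := by
    simp [hA, oneCount]
  have hBA : B n ω = n + 2 - A n ω := by linarith [hAB n ω]
  rw [hcard, urnBias, hAB, hBA]
  push_cast
  field_simp
  ring
end
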